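/- Let p > 2 and k be distinct primes, and let q = p^r for some r ≥ 1 be such that q^k ≠ 9. Let M_1, M_2 ∈ Mat_{k×k}(F_q) be such that the product M_1 M_2 is an invertible matrix of order q^k − 1. Then the subgroup of SL_{2k}(F_q) generated by the two block matrices ((I_k, M_1), (0, I_k)) and ((I_k, 0), (M_2, I_k)) is isomorphic as a group to SL_2(L), where L is a field with q^k elements. -/

import Mathlib

open Matrix

/-- Assemble a `2 × 2` array of `k × k` blocks into a `2k × 2k` matrix. -/
def blocks2 {k : ℕ} {F : Type*} (B : Matrix (Fin 2) (Fin 2) (Matrix (Fin k) (Fin k) F)) :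
    Matrix (Fin 2 × Fin k) (Fin 2 × Fin k) F :=
  Matrix.of fun p q => B p.1 q.1 p.2 q.2

section Singer

open Polynomial

theorem range_aeval_eq_of_orderOf {F : Type*} [Field F] [Fintype F] {k : ℕ} [NeZero k]
    (M : Matrix (Fin k) (Fin k) F) (hM : IsUnit M)
    (hord : orderOf M = Fintype.card F ^ k - 1) :
    (Set.range fun f : F[X] => aeval M f) =
        insert 0 ((fun i : ℕ => M ^ i) '' Set.Iio (Fintype.card F ^ k - 1)) ∧
      (Set.range fun f : F[X] => aeval M f).ncard = Fintype.card F ^ k := by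
  have hq : 0 < Fintype.card F ^ k := pow_pos Fintype.card_pos k
  have hpow : (insert 0 ((fun i : ℕ => M ^ i) '' Set.Iio (Fintype.card F ^ k - 1))).ncard =
      Fintype.card F ^ k := by
    rw [Set.ncard_insert_of_notMem _ (Set.toFinite _), Set.InjOn.ncard_image]
    · rw [← Finset.coe_Iio, Set.ncard_coe_finset, Nat.card_Iio]; omega
    · intro i hi j hj hij
      rw [← hord] at hi hj
      exact pow_injOn_Iio_orderOf hi hj hij
    · rintro ⟨i, -, hi⟩
      exact (hM.pow i).ne_zero hi
  have hsub : insert 0 ((fun i : ℕ => M ^ i) '' Set.Iio (Fintype.card F ^ k - 1)) ⊆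
      Set.range fun f : F[X] => aeval M f := by
    rintro _ (rfl | ⟨i, -, rfl⟩)
    · exact ⟨0, by simp⟩
    · exact ⟨X ^ i, by simp⟩
  have hle : (Set.range fun f : F[X] => aeval M f).ncard ≤ Fintype.card F ^ k := by
    have : (Set.range fun f : F[X] => aeval M f) ⊆
        Set.range fun v : Fin k → F => aeval M ((degreeLTEquiv F k).symm v : F[X]) := by
      rintro _ ⟨f, rfl⟩
      have hdeg : f %ₘ M.charpoly ∈ degreeLT F k := by
        rw [mem_degreeLT]
        refine (degree_modByMonic_lt f M.charpoly_monic).trans_eq ?_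
        rw [M.charpoly_degree_eq_dim, Fintype.card_fin]
      refine ⟨degreeLTEquiv F k ⟨_, hdeg⟩, ?_⟩
      simp only [LinearEquiv.symm_apply_apply]
      exact aeval_modByMonic_eq_self_of_root (aeval_self_charpoly M)
    refine (Set.ncard_le_ncard this (Set.toFinite _)).trans ?_
    rw [← Set.image_univ]
    refine (Set.ncard_image_le (Set.toFinite _)).trans_eq ?_
    simp [Set.ncard_univ]
  have heq := Set.eq_of_subset_of_ncard_le hsub (hle.trans_eq hpow.symm) (Set.toFinite _)
  exact ⟨heq.symm, heq ▸ hpow⟩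

theorem exists_field_embedding_of_orderOf {F : Type*} [Field F] [Fintype F] {k : ℕ} [NeZero k]
    (M : Matrix (Fin k) (Fin k) F) (hM : IsUnit M)
    (hord : orderOf M = Fintype.card F ^ k - 1)
    (L : Type*) [Field L] [Fintype L] (hL : Fintype.card L = Fintype.card F ^ k) :
    ∃ (φ : L →+* Matrix (Fin k) (Fin k) F) (a : L), φ a = M := by
  obtain ⟨hrange, hcard⟩ := range_aeval_eq_of_orderOf M hM hord
  have hpos : 0 < orderOf M := by
    rw [hord]
    have := Nat.one_lt_pow (NeZero.ne k) (Fintype.one_lt_card (α := F))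
    omega
  let f : F[X] →+* Matrix (Fin k) (Fin k) F := (aeval M : F[X] →ₐ[F] _).toRingHom
  let ψ : (F[X] ⧸ RingHom.ker f) →+* Matrix (Fin k) (Fin k) F := RingHom.kerLift f
  have hψ : Function.Injective ψ := RingHom.kerLift_injective f
  have hX : ψ (Ideal.Quotient.mk _ X) = M := by
    change f X = M
    simp [f]
  have hfield : IsField (F[X] ⧸ RingHom.ker f) := by
    refine ⟨⟨0, 1, fun h => zero_ne_one (α := Matrix (Fin k) (Fin k) F) ?_⟩, mul_comm,
      fun {a} ha => ?_⟩
    · simpa using congrArg ψ h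
    · obtain ⟨g, rfl⟩ := Ideal.Quotient.mk_surjective a
      have hg : aeval M g ∈ Set.range fun f : F[X] => aeval M f := ⟨g, rfl⟩
      rw [hrange] at hg
      obtain h0 | ⟨i, -, hi⟩ := hg
      · exact absurd (hψ (h0.trans (map_zero ψ).symm)) ha
      · refine ⟨Ideal.Quotient.mk _ (X ^ (i * (orderOf M - 1))), hψ ?_⟩
        have hi' : ψ (Ideal.Quotient.mk _ g) = M ^ i := hi.symm
        rw [map_mul, hi', map_pow, map_pow, hX, map_one, ← pow_add]
        obtain ⟨n, hn⟩ : ∃ n, orderOf M = n + 1 := ⟨orderOf M - 1, by omega⟩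
        rw [hn, Nat.add_sub_cancel, show i + i * n = (n + 1) * i by ring, ← hn, pow_mul,
          pow_orderOf_eq_one, one_pow]
  have := Ideal.Quotient.maximal_of_isField _ hfield
  let : Field (F[X] ⧸ RingHom.ker f) := Ideal.Quotient.field _
  have : Finite (F[X] ⧸ RingHom.ker f) := Finite.of_injective ψ hψ
  let := Fintype.ofFinite (F[X] ⧸ RingHom.ker f)
  have hc : Fintype.card L = Fintype.card (F[X] ⧸ RingHom.ker f) := by
    rw [hL, ← hcard, ← Nat.card_eq_fintype_card, ← Set.ncard_univ,
      ← Set.ncard_image_of_injective _ hψ, Set.image_univ]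
    congr 1
    ext A
    constructor
    · rintro ⟨g, rfl⟩
      exact ⟨Ideal.Quotient.mk _ g, rfl⟩
    · rintro ⟨a, rfl⟩
      obtain ⟨g, rfl⟩ := Ideal.Quotient.mk_surjective a
      exact ⟨g, rfl⟩
  let e : L ≃+* (F[X] ⧸ RingHom.ker f) := FiniteField.ringEquivOfCardEq hc
  exact ⟨ψ.comp e.toRingHom, e.symm (Ideal.Quotient.mk _ X), by simp [hX]⟩

end Singer

/-- The upper unitriangular matrix with off-diagonal entry `u`. -/
def upperUnip {R : Type*} [CommRing R] (u : R) : SpecialLinearGroup (Fin 2) R :=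
  ⟨!![1, u; 0, 1], by simp⟩

/-- The lower unitriangular matrix with off-diagonal entry `v`. -/
def lowerUnip {R : Type*} [CommRing R] (v : R) : SpecialLinearGroup (Fin 2) R :=
  ⟨!![1, 0; v, 1], by simp⟩

section Basic

variable {R : Type*} [CommRing R]

theorem SL2_ext {g h : SpecialLinearGroup (Fin 2) R} (h00 : g 0 0 = h 0 0) (h01 : g 0 1 = h 0 1)
    (h10 : g 1 0 = h 1 0) (h11 : g 1 1 = h 1 1) : g = h := by
  ext i j
  fin_cases i <;> fin_cases j <;> assumption

theorem SL2_det (g : SpecialLinearGroup (Fin 2) R) : g 0 0 * g 1 1 - g 0 1 * g 1 0 = 1 := by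
  rw [← Matrix.det_fin_two, g.det_coe]

@[simp] theorem SL2_mul_apply (g h : SpecialLinearGroup (Fin 2) R) (i j : Fin 2) :
    (g * h) i j = g i 0 * h 0 j + g i 1 * h 1 j := by
  exact (congrFun₂ (Matrix.SpecialLinearGroup.coe_mul g h) i j).trans
    (by rw [Matrix.mul_apply, Fin.sum_univ_two])

@[simp] theorem SL2_inv_00 (g : SpecialLinearGroup (Fin 2) R) : g⁻¹ 0 0 = g 1 1 := by
  simp [Matrix.adjugate_fin_two]
@[simp] theorem SL2_inv_01 (g : SpecialLinearGroup (Fin 2) R) : g⁻¹ 0 1 = -g 0 1 := by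
  simp [Matrix.adjugate_fin_two]
@[simp] theorem SL2_inv_10 (g : SpecialLinearGroup (Fin 2) R) : g⁻¹ 1 0 = -g 1 0 := by
  simp [Matrix.adjugate_fin_two]
@[simp] theorem SL2_inv_11 (g : SpecialLinearGroup (Fin 2) R) : g⁻¹ 1 1 = g 0 0 := by
  simp [Matrix.adjugate_fin_two]

@[simp] theorem upperUnip_00 (u : R) : upperUnip u 0 0 = 1 := rfl
@[simp] theorem upperUnip_01 (u : R) : upperUnip u 0 1 = u := rfl
@[simp] theorem upperUnip_10 (u : R) : upperUnip u 1 0 = 0 := rfl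
@[simp] theorem upperUnip_11 (u : R) : upperUnip u 1 1 = 1 := rfl
@[simp] theorem lowerUnip_00 (u : R) : lowerUnip u 0 0 = 1 := rfl
@[simp] theorem lowerUnip_01 (u : R) : lowerUnip u 0 1 = 0 := rfl
@[simp] theorem lowerUnip_10 (u : R) : lowerUnip u 1 0 = u := rfl
@[simp] theorem lowerUnip_11 (u : R) : lowerUnip u 1 1 = 1 := rfl

theorem upperUnip_zero : upperUnip (0 : R) = 1 := by
  apply SL2_ext <;> simp

theorem lowerUnip_zero : lowerUnip (0 : R) = 1 := by
  apply SL2_ext <;> simp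

theorem upperUnip_mul (u v : R) : upperUnip u * upperUnip v = upperUnip (u + v) := by
  apply SL2_ext <;> simp [add_comm]

theorem lowerUnip_mul (u v : R) : lowerUnip u * lowerUnip v = lowerUnip (u + v) := by
  apply SL2_ext <;> simp

theorem upperUnip_inv (u : R) : (upperUnip u)⁻¹ = upperUnip (-u) := by
  apply SL2_ext <;> simp

theorem upperUnip_pow (u : R) (n : ℕ) : upperUnip u ^ n = upperUnip (n * u) := by
  induction n with
  | zero => simp [upperUnip_zero]
  | succ n ih => rw [pow_succ, ih, upperUnip_mul]; congr 1; push_cast; ring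

theorem lowerUnip_pow (u : R) (n : ℕ) : lowerUnip u ^ n = lowerUnip (n * u) := by
  induction n with
  | zero => simp [lowerUnip_zero]
  | succ n ih => rw [pow_succ, ih, lowerUnip_mul]; congr 1; push_cast; ring

end Basic

section Field

variable {L : Type*} [Field L]

theorem eq_of_commute_upperUnip {u : L} (hu : u ≠ 0) {g : SpecialLinearGroup (Fin 2) L}
    (h : Commute (upperUnip u) g) : g 1 0 = 0 ∧ g 0 0 = g 1 1 := by
  have h00 := congrArg (fun m : SpecialLinearGroup (Fin 2) L => m 0 0) h.eq
  have h01 := congrArg (fun m : SpecialLinearGroup (Fin 2) L => m 0 1) h.eq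
  simp only [SL2_mul_apply, upperUnip_00, upperUnip_01, upperUnip_10, upperUnip_11] at h00 h01
  constructor
  · have : u * g 1 0 = 0 := by linear_combination h00
    exact (mul_eq_zero.1 this).resolve_left hu
  · have : u * (g 1 1 - g 0 0) = 0 := by linear_combination h01
    exact (sub_eq_zero.1 ((mul_eq_zero.1 this).resolve_left hu)).symm

theorem pow_apply_of_lower_zero {g : SpecialLinearGroup (Fin 2) L} (h : g 1 0 = 0) (n : ℕ) :
    (g ^ n) 1 0 = 0 ∧ (g ^ n) 0 0 = g 0 0 ^ n := by
  induction n with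
  | zero => simp
  | succ n ih => simp [pow_succ, ih.1, ih.2, h]

/-- An upper triangular `p`-element of `SL₂` in characteristic `p` is unipotent. -/
theorem eq_upperUnip_of_pow {p : ℕ} [Fact p.Prime] [CharP L p] {g : SpecialLinearGroup (Fin 2) L}
    (h : g 1 0 = 0) {n : ℕ} (hn : g ^ p ^ n = 1) : g = upperUnip (g 0 1) := by
  have h1 : g 0 0 ^ p ^ n = 1 := by
    rw [← (pow_apply_of_lower_zero h _).2, hn]; simp
  have h2 : g 0 0 = 1 := by
    have : (g 0 0 - 1) ^ p ^ n = 0 := by rw [sub_pow_char_pow, h1]; simp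
    exact sub_eq_zero.1 (pow_eq_zero_iff (pow_ne_zero n (Fact.out : p.Prime).ne_zero) |>.1 this)
  have h3 := SL2_det g
  rw [h2, h] at h3
  apply SL2_ext <;> simp [h, h2]
  linear_combination h3

/-- A `p`-subgroup of `SL₂` in characteristic `p` which contains `upperUnip 1` consists of
upper unitriangular matrices. -/
theorem eq_upperUnip_of_isPGroup {p : ℕ} [Fact p.Prime] [CharP L p] [Finite L]
    {S : Subgroup (SpecialLinearGroup (Fin 2) L)} (hS : IsPGroup p S)
    (h1 : upperUnip 1 ∈ S) {g : SpecialLinearGroup (Fin 2) L} (hg : g ∈ S) :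
    g = upperUnip (g 0 1) := by
  have : Nontrivial S := ⟨⟨⟨_, h1⟩, 1, fun h => by
    have h' := congrArg (fun m : S => (m : SpecialLinearGroup (Fin 2) L) 0 1) h
    simp at h'⟩⟩
  have := hS.center_nontrivial
  obtain ⟨z, hz⟩ := exists_ne (1 : Subgroup.center S)
  have hcomm : ∀ s : S, Commute (z : S) s := fun s => ((Subgroup.mem_center_iff.1 z.2) s).symm
  have hpow : ∀ s : S, ∃ n : ℕ, (s : SpecialLinearGroup (Fin 2) L) ^ p ^ n = 1 := fun s => by
    obtain ⟨n, hn⟩ := hS s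
    exact ⟨n, by simpa using congrArg Subtype.val hn⟩
  have hz1 : Commute (upperUnip 1) ((z : S) : SpecialLinearGroup (Fin 2) L) :=
    (congrArg Subtype.val (hcomm ⟨_, h1⟩).eq).symm
  obtain ⟨n, hn⟩ := hpow z
  have hzu := eq_upperUnip_of_pow (p := p) (eq_of_commute_upperUnip one_ne_zero hz1).1 hn
  set w := ((z : S) : SpecialLinearGroup (Fin 2) L) 0 1 with hw
  have hw0 : w ≠ 0 := fun h0 => hz (by
    apply Subtype.ext; apply Subtype.ext
    rw [hzu, h0, upperUnip_zero]; rfl)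
  have hzg : Commute (upperUnip w) g := by
    rw [← hzu]
    exact congrArg Subtype.val (hcomm ⟨g, hg⟩).eq
  obtain ⟨n, hn⟩ := hpow ⟨g, hg⟩
  exact eq_upperUnip_of_pow (p := p) (eq_of_commute_upperUnip hw0 hzg).1 hn

/-- If a subgroup of `SL₂` contains `upperUnip 1` and `lowerUnip v`, then `lowerUnip v` is
conjugate to one of its upper unitriangular elements. -/
theorem exists_upperUnip_mem_conj {p : ℕ} [Fact p.Prime] [CharP L p] [Finite L]
    {G : Subgroup (SpecialLinearGroup (Fin 2) L)} (h1 : upperUnip 1 ∈ G)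
    {v : L} (hv : lowerUnip v ∈ G) :
    ∃ u b : L, upperUnip u ∈ G ∧ v = -u * b ^ 2 := by
  have hzp : ∀ x : G, x ^ p = 1 → IsPGroup p (Subgroup.zpowers x) := fun x hx =>
    IsPGroup.of_card_dvd_pow (n := 1)
      (by rw [Nat.card_zpowers, pow_one]; exact orderOf_dvd_of_pow_eq_one hx)
  obtain ⟨S, hS⟩ := (hzp ⟨_, h1⟩ (Subtype.ext (by
    simp [upperUnip_pow, upperUnip_zero]))).exists_le_sylow
  obtain ⟨T, hT⟩ := (hzp ⟨_, hv⟩ (Subtype.ext (by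
    simp [lowerUnip_pow, lowerUnip_zero]))).exists_le_sylow
  obtain ⟨g, hg⟩ := MulAction.exists_smul_eq G T S
  have hconj : g * ⟨_, hv⟩ * g⁻¹ ∈ S := by
    rw [← hg]
    exact Subgroup.smul_mem_pointwise_smul (⟨_, hv⟩ : G) (MulAut.conj g) (T : Subgroup G)
      (hT (Subgroup.mem_zpowers _))
  obtain ⟨h, hh⟩ : ∃ h : SpecialLinearGroup (Fin 2) L, h = g := ⟨_, rfl⟩
  have hu : h * lowerUnip v * h⁻¹ = upperUnip ((h * lowerUnip v * h⁻¹) 0 1) :=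
    eq_upperUnip_of_isPGroup (S.isPGroup'.map G.subtype)
      ⟨⟨_, h1⟩, hS (Subgroup.mem_zpowers _), rfl⟩ ⟨_, hconj, by simp [hh]⟩
  have hmem : h * lowerUnip v * h⁻¹ ∈ G := by
    rw [hh]; exact mul_mem (mul_mem g.2 hv) (inv_mem g.2)
  generalize (h * lowerUnip v * h⁻¹) 0 1 = u at hu
  refine ⟨u, h 1 0, hu ▸ hmem, ?_⟩
  have hv' : lowerUnip v = h⁻¹ * upperUnip u * h := by
    rw [← hu]
    simp [mul_assoc]
  have h10 := congrArg (fun m : SpecialLinearGroup (Fin 2) L => m 1 0) hv'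
  simp only [SL2_mul_apply, SL2_inv_10, SL2_inv_11, lowerUnip_10, upperUnip_00, upperUnip_01,
    upperUnip_10, upperUnip_11] at h10
  rw [h10]; ring

/-- The upper unitriangular matrices together with one nontrivial lower one generate `SL₂`. -/
theorem eq_top_of_upperUnip_mem {G : Subgroup (SpecialLinearGroup (Fin 2) L)}
    (hu : ∀ u, upperUnip u ∈ G) {v : L} (hv0 : v ≠ 0) (hv : lowerUnip v ∈ G) : G = ⊤ := by
  have hw : upperUnip (-v⁻¹) * lowerUnip v * upperUnip (-v⁻¹) ∈ G :=
    mul_mem (mul_mem (hu _) hv) (hu _)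
  set w := upperUnip (-v⁻¹) * lowerUnip v * upperUnip (-v⁻¹) with hwdef
  have hlow : ∀ c, lowerUnip c ∈ G := fun c => by
    have : lowerUnip c = w * upperUnip (-c / v ^ 2) * w⁻¹ := by
      apply SL2_ext <;> simp [hwdef] <;> field_simp <;> ring
    rw [this]
    exact mul_mem (mul_mem hw (hu _)) (inv_mem hw)
  have hgen : ∀ g : SpecialLinearGroup (Fin 2) L, g 1 0 ≠ 0 → g ∈ G := fun g hg => by
    have : g = upperUnip ((g 0 0 - 1) / g 1 0) * lowerUnip (g 1 0) *
        upperUnip ((g 1 1 - 1) / g 1 0) := by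
      have hd := SL2_det g
      apply SL2_ext <;> simp <;> field_simp <;> first | linear_combination -hd | ring
    rw [this]
    exact mul_mem (mul_mem (hu _) (hlow _)) (hu _)
  refine eq_top_iff.2 fun g _ => ?_
  by_cases hg : g 1 0 = 0
  · have hd := SL2_det g
    have h0 : g 0 0 ≠ 0 := fun h => by simp [h, hg] at hd
    have : lowerUnip 1 * g ∈ G := hgen _ (by simp [hg, h0])
    exact (G.mul_mem_cancel_left (hlow 1)).1 this
  · exact hgen g hg

end Field

section Counting

variable {L : Type*} [Field L]
  {G : Subgroup (SpecialLinearGroup (Fin 2) L)} {N T B : Finset (SpecialLinearGroup (Fin 2) L)}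
  {U : Finset L}

theorem card_mul_le_card_mul_unipotent [DecidableEq L]
    [DecidableEq (SpecialLinearGroup (Fin 2) L)] (hN : ∀ g, g ∈ N ↔ g ∈ G ∧ g 1 0 ≠ 0)
    (hT : ∀ g, g ∈ T ↔ g ∈ N ∧ g 0 0 + g 1 1 = 2) (hB : ∀ g, g ∈ B ↔ g ∈ G ∧ g 1 0 = 0)
    (hU : ∀ u, u ∈ U ↔ upperUnip u ∈ G) :
    N.card * (U.card - 1) ≤ B.card * T.card := by
  have h0 : (0 : L) ∈ U := by rw [hU, upperUnip_zero]; exact one_mem G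
  rw [← Finset.card_erase_of_mem h0, ← Finset.card_product]
  let f : SpecialLinearGroup (Fin 2) L × L → SpecialLinearGroup (Fin 2) L :=
    fun x => x.1 * upperUnip x.2 * x.1⁻¹
  refine (Finset.card_le_mul_card_image (f := f) _ B.card fun t _ => ?_).trans
    (Nat.mul_le_mul_left _ (Finset.card_le_card ?_))
  · rcases (Finset.filter (fun x => f x = t) (N ×ˢ U.erase 0)).eq_empty_or_nonempty with h | h
    · simp [h]
    obtain ⟨⟨g₁, u₁⟩, hg₁⟩ := h
    simp only [Finset.mem_filter, Finset.mem_product, Finset.mem_erase, f, hN, hU] at hg₁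
    obtain ⟨⟨⟨hg₁, -⟩, hu₁, -⟩, rfl⟩ := hg₁
    refine Finset.card_le_card_of_injOn (fun x => g₁⁻¹ * x.1) ?_ ?_
    · rintro ⟨g, u⟩ hg
      simp only [Finset.coe_filter, Set.mem_ofPred_eq, Finset.mem_product, Finset.mem_erase, f, hN,
        hU] at hg
      obtain ⟨⟨⟨hg, -⟩, hu, -⟩, he⟩ := hg
      rw [Finset.mem_coe, hB]
      refine ⟨mul_mem (inv_mem hg₁) hg, ?_⟩
      have he' : (g₁⁻¹ * g) * upperUnip u = upperUnip u₁ * (g₁⁻¹ * g) := by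
        rw [mul_inv_eq_iff_eq_mul] at he
        rw [mul_assoc, he]; group
      change (g₁⁻¹ * g) 1 0 = 0
      generalize g₁⁻¹ * g = h at he' ⊢
      have h11 := congrArg (fun m : SpecialLinearGroup (Fin 2) L => m 0 0) he'
      simp only [SL2_mul_apply, upperUnip_00, upperUnip_01, upperUnip_10] at h11
      have : u₁ * h 1 0 = 0 := by linear_combination -h11
      exact (mul_eq_zero.1 this).resolve_left hu₁
    · rintro ⟨g, u⟩ hg ⟨g', u'⟩ hg' heq
      have heq' : g = g' := mul_left_cancel heq
      subst heq'
      simp only [Finset.coe_filter, Set.mem_ofPred_eq, f] at hg hg'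
      have h1 := mul_left_cancel (mul_right_cancel (hg.2.trans hg'.2.symm))
      have h2 := congrArg (fun m : SpecialLinearGroup (Fin 2) L => m 0 1) h1
      exact Prod.ext rfl h2
  · intro t ht
    obtain ⟨⟨g, u⟩, hg, rfl⟩ := Finset.mem_image.1 ht
    simp only [Finset.mem_product, Finset.mem_erase, hN, hU] at hg
    obtain ⟨⟨hg, hg0⟩, hu, hu'⟩ := hg
    have hd := SL2_det g
    rw [hT, hN]
    refine ⟨⟨mul_mem (mul_mem hg hu') (inv_mem hg), ?_⟩, ?_⟩
    · have : (g * upperUnip u * g⁻¹) 1 0 = -u * g 1 0 ^ 2 := by simp; ring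
      simp only [f]
      rw [this]
      exact mul_ne_zero (neg_ne_zero.2 hu) (pow_ne_zero 2 hg0)
    · simp only [f, SL2_mul_apply, upperUnip_00, upperUnip_01, upperUnip_10, upperUnip_11,
        SL2_inv_00, SL2_inv_10, SL2_inv_01, SL2_inv_11]
      linear_combination 2 * hd

theorem image_upperUnip_mul_subset [DecidableEq (SpecialLinearGroup (Fin 2) L)]
    (hN : ∀ g, g ∈ N ↔ g ∈ G ∧ g 1 0 ≠ 0)
    (hT : ∀ g, g ∈ T ↔ g ∈ N ∧ g 0 0 + g 1 1 = 2) (hU : ∀ u, u ∈ U ↔ upperUnip u ∈ G) :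
    (U ×ˢ T).image (fun x => upperUnip x.1 * x.2) ⊆ N ∧
      ((U ×ˢ T).image fun x => upperUnip x.1 * x.2).card = U.card * T.card := by
  constructor
  · intro t ht
    obtain ⟨⟨u, g⟩, hg, rfl⟩ := Finset.mem_image.1 ht
    simp only [Finset.mem_product, hN, hT, hU] at hg
    rw [hN]
    exact ⟨mul_mem hg.1 hg.2.1.1, by simpa using hg.2.1.2⟩
  · rw [Finset.card_image_of_injOn, Finset.card_product]
    rintro ⟨u, g⟩ hg ⟨u', g'⟩ hg' heq
    simp only [Finset.coe_product, Set.mem_prod, Finset.mem_coe, hT, hN] at hg hg'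
    obtain ⟨-, ⟨-, hg0⟩, hg⟩ := hg
    obtain ⟨-, -, hg'⟩ := hg'
    have h10 := congrArg (fun m : SpecialLinearGroup (Fin 2) L => m 1 0) heq
    have h00 := congrArg (fun m : SpecialLinearGroup (Fin 2) L => m 0 0) heq
    have h11 := congrArg (fun m : SpecialLinearGroup (Fin 2) L => m 1 1) heq
    simp only [SL2_mul_apply, upperUnip_00, upperUnip_01, upperUnip_10, upperUnip_11] at h10 h00 h11
    have : (u - u') * g 1 0 = 0 := by
      linear_combination h00 + h11 - hg + hg' - u' * h10
    have hu : u = u' := sub_eq_zero.1 ((mul_eq_zero.1 this).resolve_right hg0)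
    subst hu
    exact Prod.ext rfl (mul_left_cancel heq)

theorem card_borel_le [DecidableEq L] (hB : ∀ g, g ∈ B ↔ g ∈ G ∧ g 1 0 = 0)
    (hU : ∀ u, u ∈ U ↔ upperUnip u ∈ G) :
    B.card ≤ U.card * (2 * (B.image fun g => g 0 0 ^ 2).card) := by
  have h1 : B.card ≤ U.card * (B.image fun g => g 0 0).card := by
    refine Finset.card_le_mul_card_image _ _ fun a _ => ?_
    rcases (Finset.filter (fun g : SpecialLinearGroup (Fin 2) L => g 0 0 = a)
      B).eq_empty_or_nonempty with h | ⟨g₁, hg₁⟩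
    · simp [h]
    simp only [Finset.mem_filter, hB] at hg₁
    obtain ⟨⟨hg₁, hc₁⟩, rfl⟩ := hg₁
    have hd₁ := SL2_det g₁
    rw [hc₁] at hd₁
    refine Finset.card_le_card_of_injOn (fun g => (g₁⁻¹ * g) 0 1) ?_ ?_
    · intro g hg
      simp only [Finset.coe_filter, Set.mem_ofPred_eq, hB] at hg
      obtain ⟨⟨hg, hc⟩, ha⟩ := hg
      have hd := SL2_det g
      rw [hc, ha] at hd
      have : g₁⁻¹ * g = upperUnip ((g₁⁻¹ * g) 0 1) := by
        apply SL2_ext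
        · simp [hc, ha]; linear_combination hd₁
        · simp
        · simp [hc, hc₁]
        · simp [hc₁]; linear_combination hd
      rw [Finset.mem_coe, hU, ← this]
      exact mul_mem (inv_mem hg₁) hg
    · intro g hg g' hg' heq
      simp only [Finset.coe_filter, Set.mem_ofPred_eq, hB] at hg hg'
      obtain ⟨⟨-, hc⟩, ha⟩ := hg
      obtain ⟨⟨-, hc'⟩, ha'⟩ := hg'
      have ha0 : g₁ 0 0 ≠ 0 := fun h => by simp [h] at hd₁
      have ha1 : g₁ 1 1 ≠ 0 := fun h => by simp [h] at hd₁
      have hd := SL2_det g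
      have hd' := SL2_det g'
      rw [hc, ha] at hd
      rw [hc', ha'] at hd'
      have h11 : g 1 1 = g' 1 1 := mul_left_cancel₀ ha0 (by linear_combination hd - hd')
      simp only [SL2_mul_apply, SL2_inv_00, SL2_inv_01, h11] at heq
      exact SL2_ext (ha.trans ha'.symm) (mul_left_cancel₀ ha1 (by linear_combination heq))
        (hc.trans hc'.symm) h11
  refine h1.trans (Nat.mul_le_mul_left _ ?_)
  have himg : (B.image fun g => g 0 0 ^ 2) = (B.image fun g => g 0 0).image (· ^ 2) := by
    rw [Finset.image_image]; rfl
  rw [himg]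
  refine Finset.card_le_mul_card_image _ _ fun b hb => ?_
  obtain ⟨a, -, rfl⟩ := Finset.mem_image.1 hb
  refine (Finset.card_le_card (t := {a, -a}) fun x hx => ?_).trans Finset.card_le_two
  simpa using sq_eq_sq_iff_eq_or_eq_neg.1 (Finset.mem_filter.1 hx).2

end Counting

section Primitive

variable {L : Type*} [Field L]

/-- The upper unitriangular part of a subgroup of `SL₂`, as an additive subgroup of the field. -/
def upperPart (G : Subgroup (SpecialLinearGroup (Fin 2) L)) : AddSubgroup L where
  carrier := {u | upperUnip u ∈ G}
  zero_mem' := by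
    change upperUnip 0 ∈ G
    rw [upperUnip_zero]; exact one_mem G
  add_mem' {a b} ha hb := by
    change upperUnip (a + b) ∈ G
    rw [← upperUnip_mul]; exact mul_mem ha hb
  neg_mem' {a} ha := by
    change upperUnip (-a) ∈ G
    rw [← upperUnip_inv]; exact inv_mem ha

theorem mem_upperPart {G : Subgroup (SpecialLinearGroup (Fin 2) L)} {u : L} :
    u ∈ upperPart G ↔ upperUnip u ∈ G := Iff.rfl

theorem sq_mul_mem_upperPart {G : Subgroup (SpecialLinearGroup (Fin 2) L)}
    {g : SpecialLinearGroup (Fin 2) L} (hg : g ∈ G) (hc : g 1 0 = 0) {u : L}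
    (hu : u ∈ upperPart G) : g 0 0 ^ 2 * u ∈ upperPart G := by
  have hd := SL2_det g
  rw [hc] at hd
  have : upperUnip (g 0 0 ^ 2 * u) = g * upperUnip u * g⁻¹ := by
    apply SL2_ext <;> simp [hc]
    · linear_combination -hd
    · ring
    · linear_combination -hd
  rw [mem_upperPart, this]
  exact mul_mem (mul_mem hg hu) (inv_mem hg)

/-- An additive subgroup containing `1` and stable under a set of multipliers which makes up
at least half of its nonzero elements is closed under multiplication. -/
theorem AddSubgroup.mul_mem_of_card_le [Finite L] (U : AddSubgroup L) (h1 : 1 ∈ U) (E : Finset L)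
    (hE0 : (0 : L) ∉ E) (hE : ∀ e ∈ E, ∀ u ∈ U, e * u ∈ U)
    (hcard : Nat.card U ≤ 2 * E.card + 1) {a b : L} (ha : a ∈ U) (hb : b ∈ U) : a * b ∈ U := by
  classical
  let K : AddSubgroup L :=
    { carrier := {a | ∀ u ∈ U, a * u ∈ U}
      zero_mem' := fun u _ => by rw [zero_mul]; exact U.zero_mem
      add_mem' := fun {a b} ha hb u hu => by rw [add_mul]; exact U.add_mem (ha u hu) (hb u hu)
      neg_mem' := fun {a} ha u hu => by rw [neg_mul]; exact U.neg_mem (ha u hu) }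
  have hKU : K ≤ U := fun a ha => by simpa using ha 1 h1
  have hEK : E.card + 1 ≤ Nat.card K := by
    rw [← Finset.card_insert_of_notMem hE0, ← Set.ncard_coe_finset]
    refine Set.ncard_le_ncard (t := (K : Set L)) ?_ (Set.toFinite _)
    intro x hx
    rcases Finset.mem_insert.1 (Finset.mem_coe.1 hx) with rfl | hx
    · exact K.zero_mem
    · exact hE x hx
  obtain ⟨c, hc⟩ := AddSubgroup.card_dvd_of_le hKU
  have hc2 : c < 2 := by
    by_contra! h
    have := Nat.mul_le_mul_left (Nat.card K) h
    omega
  have hle : Nat.card U ≤ Nat.card K := by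
    rw [hc]
    calc Nat.card K * c ≤ Nat.card K * 1 := Nat.mul_le_mul_left _ (by omega)
      _ = _ := mul_one _
  have heq := AddSubgroup.eq_of_le_of_card_ge hKU hle
  rw [← heq] at ha
  exact ha b hb

theorem isSquare_of_mem_of_card_le [Finite L] (U : AddSubgroup L) (E : Finset L)
    (hE0 : (0 : L) ∉ E) (hEU : ∀ e ∈ E, e ∈ U) (hmul : ∀ e ∈ E, ∀ u ∈ U, e * u ∈ U)
    (hsq : ∀ e ∈ E, IsSquare e) (hcard : Nat.card U ≤ 2 * E.card)
    {u : L} (hu : u ∈ U) : IsSquare u := by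
  classical
  rcases eq_or_ne u 0 with rfl | hu0
  · exact IsSquare.zero
  have hfin : (U : Set L).Finite := Set.toFinite _
  have h0 : (0 : L) ∈ hfin.toFinset := by simp
  have hUc : (hfin.toFinset.erase 0).card + 1 = Nat.card U := by
    rw [Finset.card_erase_add_one h0, ← Set.ncard_eq_toFinset_card]; rfl
  obtain ⟨x, hx⟩ := Finset.inter_nonempty_of_card_lt_card_add_card
    (s := hfin.toFinset.erase 0) (t := E) (u := E.image (· * u))
    (fun e he => by simpa using ⟨fun h => hE0 (h ▸ he), hEU e he⟩)
    (fun x hx => by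
      obtain ⟨e, he, rfl⟩ := Finset.mem_image.1 hx
      simpa [hu0] using ⟨fun h => hE0 (h ▸ he), hmul e he u hu⟩)
    (by
      rw [Finset.card_image_of_injective _ (mul_left_injective₀ hu0)]
      omega)
  obtain ⟨hxE, hx⟩ := Finset.mem_inter.1 hx
  obtain ⟨e, he, rfl⟩ := Finset.mem_image.1 hx
  have he0 : e ≠ 0 := fun h => hE0 (h ▸ he)
  have : u = e * u / e := by field_simp
  rw [this]
  exact (hsq _ hxE).div (hsq _ he)

theorem not_isSquare_of_orderOf [Fintype L] (h2 : ringChar L ≠ 2) {v : L} (hv0 : v ≠ 0)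
    (hv : orderOf v = Fintype.card L - 1) : ¬ IsSquare v := by
  intro h
  have h1 := orderOf_dvd_of_pow_eq_one ((FiniteField.isSquare_iff h2 hv0).1 h)
  have hodd := FiniteField.odd_card_of_char_ne_two h2
  have := Fintype.one_lt_card (α := L)
  have := Nat.le_of_dvd (by omega) h1
  omega

/-- In odd characteristic, `!![1, 1; 0, 1]` and `!![1, 0; v, 1]` generate `SL₂` over a finite
field whose multiplicative group is generated by `v`. -/
theorem eq_top_of_orderOf [Fintype L] (h2 : ringChar L ≠ 2) {v : L}
    (hv : orderOf v = Fintype.card L - 1) {G : Subgroup (SpecialLinearGroup (Fin 2) L)}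
    (h1 : upperUnip 1 ∈ G) (hvG : lowerUnip v ∈ G) : G = ⊤ := by
  classical
  have hL := Fintype.one_lt_card (α := L)
  have hv0 : v ≠ 0 := by
    rintro rfl
    have := pow_orderOf_eq_one (0 : L)
    rw [hv, zero_pow (by omega)] at this
    exact zero_ne_one this
  let := Fintype.ofFinite (SpecialLinearGroup (Fin 2) L)
  let N := Finset.univ.filter fun g : SpecialLinearGroup (Fin 2) L => g ∈ G ∧ g 1 0 ≠ 0
  let B := Finset.univ.filter fun g : SpecialLinearGroup (Fin 2) L => g ∈ G ∧ g 1 0 = 0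
  let T := N.filter fun g => g 0 0 + g 1 1 = 2
  let U := Finset.univ.filter fun u : L => upperUnip u ∈ G
  let E := B.image fun g => g 0 0 ^ 2
  have hN : ∀ g, g ∈ N ↔ g ∈ G ∧ g 1 0 ≠ 0 := fun g => by simp [N]
  have hB : ∀ g, g ∈ B ↔ g ∈ G ∧ g 1 0 = 0 := fun g => by simp [B]
  have hT : ∀ g, g ∈ T ↔ g ∈ N ∧ g 0 0 + g 1 1 = 2 := fun g => by simp [T]
  have hU : ∀ u, u ∈ U ↔ upperUnip u ∈ G := fun u => by simp [U]
  have hUcard : Nat.card (upperPart G) = U.card := by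
    rw [← Set.ncard_coe_finset]
    change (upperPart G : Set L).ncard = _
    congr 1
    ext u
    rw [Finset.mem_coe, hU]; rfl
  have hE : ∀ e ∈ E, ∃ g ∈ G, g 1 0 = 0 ∧ e = g 0 0 ^ 2 := fun e he => by
    obtain ⟨g, hg, rfl⟩ := Finset.mem_image.1 he
    exact ⟨g, ((hB g).1 hg).1, ((hB g).1 hg).2, rfl⟩
  have hE0 : (0 : L) ∉ E := fun h => by
    obtain ⟨g, -, hc, h0⟩ := hE 0 h
    have hd := SL2_det g
    rw [pow_eq_zero_iff two_ne_zero |>.1 h0.symm, hc] at hd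
    simp at hd
  have hEmul : ∀ e ∈ E, ∀ u ∈ upperPart G, e * u ∈ upperPart G := fun e he u hu => by
    obtain ⟨g, hg, hc, rfl⟩ := hE e he
    exact sq_mul_mem_upperPart hg hc hu
  have hEU : ∀ e ∈ E, e ∈ upperPart G := fun e he => by simpa using hEmul e he 1 h1
  have hNpos : 0 < N.card := Finset.card_pos.2 ⟨lowerUnip v, (hN _).2 ⟨hvG, hv0⟩⟩
  have hBpos : 0 < B.card := Finset.card_pos.2 ⟨1, (hB _).2 ⟨one_mem G, by simp⟩⟩
  have hUpos : 0 < U.card := Finset.card_pos.2 ⟨1, (hU _).2 h1⟩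
  have hA := card_mul_le_card_mul_unipotent hN hT hB hU
  have hC : B.card ≤ U.card * (2 * E.card) := card_borel_le hB hU
  obtain ⟨hsub, himg⟩ := image_upperUnip_mul_subset hN hT hU
  have hTN : U.card * T.card ≤ N.card := himg ▸ Finset.card_le_card hsub
  have hkey : N.card * U.card * (U.card - 1) ≤ B.card * (U.card * T.card) := by
    calc _ = U.card * (N.card * (U.card - 1)) := by ring
      _ ≤ U.card * (B.card * T.card) := Nat.mul_le_mul_left _ hA
      _ = _ := by ring
  have hBN : B.card * N.card ≤ N.card * U.card * (2 * E.card) := by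
    calc _ ≤ U.card * (2 * E.card) * N.card := Nat.mul_le_mul_right _ hC
      _ = _ := by ring
  have hweak : U.card - 1 ≤ 2 * E.card :=
    Nat.le_of_mul_le_mul_left (hkey.trans ((Nat.mul_le_mul_left _ hTN).trans hBN))
      (Nat.mul_pos hNpos hUpos)
  have hmul : ∀ {a b : L}, a ∈ upperPart G → b ∈ upperPart G → a * b ∈ upperPart G :=
    (upperPart G).mul_mem_of_card_le h1 E hE0 hEmul (by omega)
  have hpow : ∀ {a : L}, a ∈ upperPart G → ∀ n : ℕ, a ^ n ∈ upperPart G := fun {a} ha n => by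
    induction n with
    | zero => rw [pow_zero]; exact h1
    | succ n ih => rw [pow_succ]; exact hmul ih ha
  have hvU : v ∈ upperPart G := by
    by_contra hvU
    have htwo : (2 : L) ∈ upperPart G := by
      rw [← one_add_one_eq_two]; exact add_mem h1 h1
    have h20 : (2 : L) ≠ 0 := Ring.two_ne_zero h2
    have hv2 : 2 + v ≠ 0 := fun h => hvU (by
      rw [eq_neg_of_add_eq_zero_right h]; exact neg_mem htwo)
    have hlt : U.card * T.card < N.card := by
      rw [← himg]
      refine Finset.card_lt_card (Finset.ssubset_iff_subset_ne.2 ⟨hsub, fun heq => ?_⟩)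
      have hg : lowerUnip v * upperUnip 1 * lowerUnip v ∈ N := by
        rw [hN]
        refine ⟨mul_mem (mul_mem hvG h1) hvG, ?_⟩
        have : (lowerUnip v * upperUnip 1 * lowerUnip v : SpecialLinearGroup (Fin 2) L) 1 0 = v * (2 + v) := by simp; ring
        rw [this]
        exact mul_ne_zero hv0 hv2
      rw [← heq] at hg
      obtain ⟨⟨u, g⟩, hug, he⟩ := Finset.mem_image.1 hg
      rw [Finset.mem_product, hU, hT] at hug
      obtain ⟨hu, -, hg⟩ := hug
      have h10 := congrArg (fun m : SpecialLinearGroup (Fin 2) L => m 1 0) he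
      have h00 := congrArg (fun m : SpecialLinearGroup (Fin 2) L => m 0 0) he
      have h11 := congrArg (fun m : SpecialLinearGroup (Fin 2) L => m 1 1) he
      simp at h10 h00 h11 hg
      have h3 : v * (u * (2 + v) - 2) = 0 := by
        linear_combination h00 + h11 - hg - u * h10
      have h4 : u * (2 + v) = 2 := sub_eq_zero.1 ((mul_eq_zero.1 h3).resolve_left hv0)
      have hu0 : u ≠ 0 := by rintro rfl; simp at h4; exact h20 h4.symm
      have huinv : u⁻¹ ∈ upperPart G := by
        have : u⁻¹ = u ^ (Fintype.card L - 2) := by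
          apply inv_eq_of_mul_eq_one_right
          rw [← pow_succ', show Fintype.card L - 2 + 1 = Fintype.card L - 1 by omega,
            FiniteField.pow_card_sub_one_eq_one u hu0]
        rw [this]; exact hpow hu _
      apply hvU
      have : v = 2 * u⁻¹ - 2 := by field_simp; linear_combination h4
      rw [this]
      exact sub_mem (hmul htwo huinv) htwo
    have hstrong : U.card - 1 < 2 * E.card :=
      Nat.lt_of_mul_lt_mul_left
        (hkey.trans_lt ((Nat.mul_lt_mul_of_pos_left hlt hBpos).trans_le hBN))
    have : Fact (ringChar L).Prime := ⟨CharP.char_is_prime L _⟩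
    obtain ⟨u, b, hu, hub⟩ := exists_upperUnip_mem_conj (p := ringChar L) h1 hvG
    have hsq : IsSquare (-u) := isSquare_of_mem_of_card_le (upperPart G) E hE0 hEU hEmul
      (fun e he => by obtain ⟨g, -, -, rfl⟩ := hE e he; exact IsSquare.sq _)
      (by omega) (neg_mem (mem_upperPart.2 hu))
    exact not_isSquare_of_orderOf h2 hv0 hv (hub ▸ hsq.mul (IsSquare.sq b))
  have hUuniv : U = Finset.univ := by
    rw [← Finset.card_eq_iff_eq_univ]
    refine le_antisymm (Finset.card_le_univ _) ?_
    have h0 : (0 : L) ∈ U := (hU 0).2 (upperPart G).zero_mem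
    have hle : ((Finset.range (orderOf v)).image (v ^ ·)).card ≤ (U.erase 0).card :=
      Finset.card_le_card fun x hx => by
        obtain ⟨n, -, rfl⟩ := Finset.mem_image.1 hx
        exact Finset.mem_erase.2 ⟨pow_ne_zero n hv0, (hU _).2 (hpow hvU n)⟩
    rw [Finset.card_image_of_injOn (by simpa using pow_injOn_Iio_orderOf (x := v)),
      Finset.card_range, hv, Finset.card_erase_of_mem h0] at hle
    omega
  exact eq_top_of_upperUnip_mem (fun u => (hU u).1 (hUuniv ▸ Finset.mem_univ u)) hv0 hvG

end Primitive

section BlockEmbedding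

variable {F L : Type*} [Field F] [Field L] {k : ℕ}

theorem blocks2_mul (A B : Matrix (Fin 2) (Fin 2) (Matrix (Fin k) (Fin k) F)) :
    blocks2 (A * B) = blocks2 A * blocks2 B :=
  map_mul (Matrix.compRingEquiv (Fin 2) (Fin k) F) A B

theorem blocks2_one : blocks2 (1 : Matrix (Fin 2) (Fin 2) (Matrix (Fin k) (Fin k) F)) = 1 :=
  map_one (Matrix.compRingEquiv (Fin 2) (Fin k) F)

theorem blocks2_injective :
    Function.Injective (blocks2 : Matrix (Fin 2) (Fin 2) (Matrix (Fin k) (Fin k) F) → _) :=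
  (Matrix.compRingEquiv (Fin 2) (Fin k) F).injective

/-- The embedding of `SL₂(L)` into block matrices induced by a ring homomorphism from `L` to
`k × k` matrices, followed by conjugation by a pair of mutually inverse matrices. -/
def blockHom (φ : L →+* Matrix (Fin k) (Fin k) F)
    (D D' : Matrix (Fin 2) (Fin 2) (Matrix (Fin k) (Fin k) F)) (hD : D * D' = 1)
    (hD' : D' * D = 1) :
    SpecialLinearGroup (Fin 2) L →* Matrix (Fin 2 × Fin k) (Fin 2 × Fin k) F where
  toFun g := blocks2 (D' * φ.mapMatrix (g : Matrix (Fin 2) (Fin 2) L) * D)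
  map_one' := by
    rw [Matrix.SpecialLinearGroup.coe_one, map_one, mul_one, hD', blocks2_one]
  map_mul' g h := by
    rw [Matrix.SpecialLinearGroup.coe_mul, map_mul, ← blocks2_mul]
    congr 1
    calc _ = D' * φ.mapMatrix (g : Matrix (Fin 2) (Fin 2) L) * 1 *
          φ.mapMatrix (h : Matrix (Fin 2) (Fin 2) L) * D := by simp only [mul_one, mul_assoc]
      _ = _ := by rw [← hD]; simp only [mul_assoc]

theorem blockHom_injective [NeZero k] (φ : L →+* Matrix (Fin k) (Fin k) F)
    (D D' : Matrix (Fin 2) (Fin 2) (Matrix (Fin k) (Fin k) F)) (hD : D * D' = 1)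
    (hD' : D' * D = 1) : Function.Injective (blockHom φ D D' hD hD') := by
  intro g h heq
  have h1 : D' * φ.mapMatrix (g : Matrix (Fin 2) (Fin 2) L) * D =
      D' * φ.mapMatrix (h : Matrix (Fin 2) (Fin 2) L) * D := blocks2_injective heq
  have h2 := congrArg (fun A => D * A * D') h1
  have h3 : ∀ A, D * (D' * A * D) * D' = A := fun A => by
    rw [mul_assoc, mul_assoc, mul_assoc, hD, mul_one, ← mul_assoc, hD, one_mul]
  simp only [h3] at h2
  apply Subtype.ext
  ext i j
  exact φ.injective (congrFun₂ h2 i j)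

theorem map_fin_two {α β : Type*} (f : α → β) (a b c d : α) :
    !![a, b; c, d].map f = !![f a, f b; f c, f d] := by
  ext i j
  fin_cases i <;> fin_cases j <;> rfl

theorem closure_mulEquiv_SL2 [Fintype F] [Fintype L] [NeZero k] (h2 : ringChar L ≠ 2)
    (hL : Fintype.card L = Fintype.card F ^ k) (φ : L →+* Matrix (Fin k) (Fin k) F) {a : L}
    (ha : orderOf a = Fintype.card L - 1) {M₁ M₂ : Matrix (Fin k) (Fin k) F} (hM₁ : IsUnit M₁)
    (hφ : φ a = M₁ * M₂) :
    Nonempty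
      ((Subgroup.closure {g : SpecialLinearGroup (Fin 2 × Fin k) F |
          (g : Matrix (Fin 2 × Fin k) (Fin 2 × Fin k) F) = blocks2 !![1, M₁; 0, 1] ∨
          (g : Matrix (Fin 2 × Fin k) (Fin 2 × Fin k) F) = blocks2 !![1, 0; M₂, 1]})
        ≃* SpecialLinearGroup (Fin 2) L) := by
  obtain ⟨u, rfl⟩ := hM₁
  have hD : !![1, 0; 0, (u : Matrix (Fin k) (Fin k) F)] *
      !![1, 0; 0, ((u⁻¹ : (Matrix (Fin k) (Fin k) F)ˣ) : Matrix (Fin k) (Fin k) F)] = 1 := by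
    simp [Matrix.one_fin_two]
  have hD' : !![1, 0; 0, ((u⁻¹ : (Matrix (Fin k) (Fin k) F)ˣ) : Matrix (Fin k) (Fin k) F)] *
      !![1, 0; 0, (u : Matrix (Fin k) (Fin k) F)] = 1 := by
    simp [Matrix.one_fin_two]
  have hinj := blockHom_injective φ _ _ hD hD'
  set Φ := blockHom φ _ _ hD hD'
  have hx : Φ (upperUnip 1) = blocks2 !![1, ↑u; 0, 1] := by
    change blocks2 (_ * !![1, 1; 0, 1].map φ * _) = _
    congr 1
    rw [map_fin_two, Matrix.mul_fin_two, Matrix.mul_fin_two]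
    simp [-Matrix.coe_units_inv]
  have hy : Φ (lowerUnip a) = blocks2 !![1, 0; M₂, 1] := by
    change blocks2 (_ * !![1, 0; a, 1].map φ * _) = _
    congr 1
    rw [map_fin_two, Matrix.mul_fin_two, Matrix.mul_fin_two]
    simp [-Matrix.coe_units_inv, hφ]
  have hgen : Subgroup.closure {upperUnip 1, lowerUnip a} = ⊤ :=
    eq_top_of_orderOf h2 ha (Subgroup.subset_closure (by simp)) (Subgroup.subset_closure (by simp))
  have hdet_pow : ∀ g : SpecialLinearGroup (Fin 2) L, g ^ Fintype.card L = 1 → (Φ g).det = 1 := by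
    intro g hg
    rw [← FiniteField.pow_card_pow k (Φ g).det, ← hL, ← det_pow, ← map_pow, hg, map_one, det_one]
  have hdet : ∀ g, (Φ g).det = 1 := fun g => by
    have hg : g ∈ Subgroup.closure {upperUnip 1, lowerUnip a} := hgen ▸ Subgroup.mem_top g
    induction hg using Subgroup.closure_induction with
    | mem x hx =>
      apply hdet_pow
      rcases hx with rfl | rfl
      · rw [upperUnip_pow, FiniteField.cast_card_eq_zero, zero_mul, upperUnip_zero]
      · rw [lowerUnip_pow, FiniteField.cast_card_eq_zero, zero_mul, lowerUnip_zero]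
    | one => rw [map_one, det_one]
    | mul x y _ _ hx hy => rw [map_mul, det_mul, hx, hy, one_mul]
    | inv x _ hx =>
      have : (Φ x⁻¹ * Φ x).det = 1 := by rw [← map_mul, inv_mul_cancel, map_one, det_one]
      rwa [det_mul, hx, mul_one] at this
  let Ψ : SpecialLinearGroup (Fin 2) L →* SpecialLinearGroup (Fin 2 × Fin k) F :=
    { toFun := fun g => ⟨Φ g, hdet g⟩
      map_one' := Subtype.ext (map_one Φ)
      map_mul' := fun g h => Subtype.ext (map_mul Φ g h) }
  have hΨ : Function.Injective Ψ := fun g h heq => hinj (congrArg Subtype.val heq)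
  have hset : {g : SpecialLinearGroup (Fin 2 × Fin k) F |
      (g : Matrix (Fin 2 × Fin k) (Fin 2 × Fin k) F) = blocks2 !![1, ↑u; 0, 1] ∨
      (g : Matrix (Fin 2 × Fin k) (Fin 2 × Fin k) F) = blocks2 !![1, 0; M₂, 1]} =
      Ψ '' {upperUnip 1, lowerUnip a} := by
    rw [Set.image_pair]
    ext g
    rw [Set.mem_insert_iff, Set.mem_singleton_iff, ← hx, ← hy]
    exact or_congr (Subtype.ext_iff (a2 := Ψ (upperUnip 1))).symm
      (Subtype.ext_iff (a2 := Ψ (lowerUnip a))).symm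
  rw [hset, ← MonoidHom.map_closure, hgen, ← MonoidHom.range_eq_map]
  exact ⟨(MonoidHom.ofInjective hΨ).symm⟩

end BlockEmbedding

theorem stmt7 (p r q k : ℕ) (hp : p.Prime) (hk : k.Prime) (hp2 : 2 < p) (hpk : p ≠ k)
    (hr : 1 ≤ r) (hq : q = p ^ r) (h9 : q ^ k ≠ 9)
    (F : Type) [Field F] [Fintype F] (hF : Fintype.card F = q)
    (M₁ M₂ : Matrix (Fin k) (Fin k) F)
    (hunit : IsUnit (M₁ * M₂)) (hord : orderOf (M₁ * M₂) = q ^ k - 1) :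
    ∀ (L : Type) [Field L] [Fintype L], Fintype.card L = q ^ k →
      Nonempty
        ((Subgroup.closure {g : Matrix.SpecialLinearGroup (Fin 2 × Fin k) F |
            (g : Matrix (Fin 2 × Fin k) (Fin 2 × Fin k) F) = blocks2 !![1, M₁; 0, 1] ∨
            (g : Matrix (Fin 2 × Fin k) (Fin 2 × Fin k) F) = blocks2 !![1, 0; M₂, 1]})
          ≃* Matrix.SpecialLinearGroup (Fin 2) L) := by
  intro L _ _ hL
  have : NeZero k := ⟨hk.ne_zero⟩
  subst hF
  obtain ⟨φ, a, ha⟩ := exists_field_embedding_of_orderOf (M₁ * M₂) hunit hord L hL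
  have h2 : ringChar L ≠ 2 := by
    intro h
    rw [FiniteField.even_card_iff_char_two, ← Nat.even_iff, hL, hq] at h
    have hodd : Odd ((p ^ r) ^ k) := ((hp.odd_of_ne_two hp2.ne').pow).pow
    exact Nat.not_even_iff_odd.2 hodd h
  have horder : orderOf a = Fintype.card L - 1 := by
    rw [hL, ← hord, ← ha]
    exact (orderOf_injective φ.toMonoidHom φ.injective a).symm
  have hM₁ : IsUnit M₁ := by
    rw [Matrix.isUnit_iff_isUnit_det] at hunit ⊢
    rw [det_mul] at hunit
    exact isUnit_of_mul_isUnit_left hunit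
  exact closure_mulEquiv_SL2 h2 hL φ horder hM₁ ha
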